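/- Main theorem: for every global solution X : [0, +∞) → ℝ³ of the oscillator with X₀ = X(0), there exists a point X* ∈ E with V(X*) ≤ V(X₀) such that X(t) → X* as t → +∞, where E = {(x, z, v) ∈ ℝ³ : h₁(x) = −h₂(z) and v = 0} and V(x, z, v) = ∫₀ˣ h₁(s) ds + ∫₀ᶻ h₂(s) ds + v²/2. In particular, every trajectory of the oscillator converges to an equilibrium point. -/

import Mathlib

open Filter Set Topology

/-- Barbalat's lemma: if `F` converges at infinity and its derivative is uniformly continuous,
then the derivative tends to `0`. -/
theorem tendsto_zero_of_hasDerivWithinAt_of_uniformContinuousOn {F G : ℝ → ℝ} {L : ℝ}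
    (hF : ∀ t ∈ Ici (0 : ℝ), HasDerivWithinAt F (G t) (Ici 0) t)
    (hG : UniformContinuousOn G (Ici 0)) (hL : Tendsto F atTop (𝓝 L)) :
    Tendsto G atTop (𝓝 0) := by
  rw [Metric.tendsto_atTop]
  intro ε hε
  obtain ⟨δ, hδ, hδG⟩ := Metric.uniformContinuousOn_iff.1 hG (ε / 2) (by positivity)
  obtain ⟨N, hN⟩ := Metric.tendsto_atTop.1 hL (ε * δ / 8) (by positivity)
  refine ⟨max N 0, fun t ht => ?_⟩
  have htN : N ≤ t := le_trans (le_max_left _ _) ht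
  have ht0 : 0 ≤ t := le_trans (le_max_right _ _) ht
  have hcont : ContinuousOn F (Icc t (t + δ / 2)) := fun s hs =>
    ((hF s (ht0.trans hs.1)).continuousWithinAt).mono fun r hr => ht0.trans hr.1
  obtain ⟨s, hs, hsG⟩ := exists_hasDerivAt_eq_slope F G (by linarith : t < t + δ / 2) hcont
    fun s hs => (hF s (ht0.trans hs.1.le)).hasDerivAt (Ici_mem_nhds (ht0.trans_lt hs.1))
  have h1 := hN t htN
  have h2 := hN (t + δ / 2) (by linarith)
  have h3 := hδG t ht0 s (ht0.trans hs.1.le) (by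
    rw [Real.dist_eq, abs_lt]; constructor <;> linarith [hs.1, hs.2])
  rw [eq_div_iff (by linarith)] at hsG
  rw [Real.dist_eq, abs_lt] at h1 h2 h3 ⊢
  have h4 : G s < ε / 2 := by
    by_contra! h
    nlinarith
  have h5 : -(ε / 2) < G s := by
    by_contra! h
    nlinarith
  constructor <;> linarith

/-- If `u` eventually stays in a compact set and `D ∘ u` converges to `d`, where `D` is
continuous, then `D` takes the value `d` on this compact set. -/
theorem IsCompact.exists_eq_of_tendsto_comp {ι X Y : Type*} [TopologicalSpace X]
    [TopologicalSpace Y] [T2Space Y] {K : Set X} (hK : IsCompact K) {l : Filter ι} [l.NeBot]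
    {u : ι → X} (hu : ∀ᶠ t in l, u t ∈ K) {D : X → Y} (hD : Continuous D) {d : Y}
    (hd : Tendsto (fun t => D (u t)) l (𝓝 d)) : ∃ p ∈ K, D p = d := by
  obtain ⟨p, hp, hup⟩ := hK.ultrafilter_le_nhds ((Ultrafilter.of l).map u)
    (le_principal_iff.2 (Ultrafilter.of_le l hu))
  exact ⟨p, hp, tendsto_nhds_unique ((hD.tendsto p).comp hup)
    (hd.mono_left (Ultrafilter.of_le l))⟩

/-- If `u` eventually stays in a compact set, `D ∘ u` converges to `d`, and the continuous
function `φ` equals `e` wherever `D` equals `d`, then `φ ∘ u` converges to `e`. -/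
theorem IsCompact.tendsto_comp_of_tendsto_comp {ι X Y Z : Type*} [TopologicalSpace X]
    [TopologicalSpace Y] [T2Space Y] [TopologicalSpace Z] {K : Set X} (hK : IsCompact K)
    {l : Filter ι} {u : ι → X} (hu : ∀ᶠ t in l, u t ∈ K)
    {D : X → Y} (hD : Continuous D) {d : Y} (hd : Tendsto (fun t => D (u t)) l (𝓝 d))
    {φ : X → Z} (hφ : Continuous φ) {e : Z} (he : ∀ p, D p = d → φ p = e) :
    Tendsto (fun t => φ (u t)) l (𝓝 e) := by
  rw [tendsto_iff_ultrafilter]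
  intro g hg
  obtain ⟨p, -, hup⟩ := hK.ultrafilter_le_nhds (g.map u) (le_principal_iff.2 (hg hu))
  have hp : D p = d := tendsto_nhds_unique ((hD.tendsto p).comp hup) (hd.mono_left hg)
  rw [← he p hp]
  exact (hφ.tendsto p).comp hup

/-- The tangent line inequality for the primitive of a monotone function. -/
theorem Monotone.mul_sub_le_integral {h : ℝ → ℝ} (hm : Monotone h) (hc : Continuous h)
    (a y : ℝ) : h a * (y - a) ≤ (∫ s in (0 : ℝ)..y, h s) - ∫ s in (0 : ℝ)..a, h s := by
  rw [intervalIntegral.integral_interval_sub_left (hc.intervalIntegrable _ _)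
    (hc.intervalIntegrable _ _)]
  rcases le_total a y with hay | hay
  · have := intervalIntegral.integral_mono_on hay
      (intervalIntegrable_const (c := h a) (μ := MeasureTheory.volume))
      (hc.intervalIntegrable a y) (fun s hs => hm hs.1)
    rw [intervalIntegral.integral_const, smul_eq_mul] at this
    linarith
  · have := intervalIntegral.integral_mono_on hay (hc.intervalIntegrable y a)
      (intervalIntegrable_const (c := h a) (μ := MeasureTheory.volume)) (fun s hs => hm hs.2)
    rw [intervalIntegral.integral_const, smul_eq_mul] at this
    rw [intervalIntegral.integral_symm]
    linarith

theorem StrictMono.integral_nonneg_of_map_zero {h : ℝ → ℝ} (hm : StrictMono h)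
    (hc : Continuous h) (h0 : h 0 = 0) (y : ℝ) : 0 ≤ ∫ s in (0 : ℝ)..y, h s := by
  simpa [h0] using hm.monotone.mul_sub_le_integral hc 0 y

/-- The primitive of a strictly increasing function vanishing at `0` has bounded sublevel sets. -/
theorem StrictMono.exists_mem_Icc_of_integral_le {h : ℝ → ℝ} (hm : StrictMono h)
    (hc : Continuous h) (h0 : h 0 = 0) (M : ℝ) :
    ∃ a b : ℝ, ∀ y, (∫ s in (0 : ℝ)..y, h s) ≤ M → y ∈ Icc a b := by
  have hp : 0 < h 1 := h0 ▸ hm one_pos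
  have hn : h (-1) < 0 := h0 ▸ hm (by norm_num : (-1 : ℝ) < 0)
  refine ⟨-1 + M / h (-1), 1 + M / h 1, fun y hy => ⟨?_, ?_⟩⟩
  · have h1 := hm.monotone.mul_sub_le_integral hc (-1) y
    have h2 := hm.integral_nonneg_of_map_zero hc h0 (-1)
    have : M / h (-1) ≤ y + 1 := (div_le_iff_of_neg hn).2 (by linarith)
    linarith
  · have h1 := hm.monotone.mul_sub_le_integral hc 1 y
    have h2 := hm.integral_nonneg_of_map_zero hc h0 1
    have : y - 1 ≤ M / h 1 := (le_div_iff₀ hp).2 (by linarith)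
    linarith

/-- Two equilibria with abscissas of the same strict sign have different energies. -/
theorem StrictMono.integral_add_integral_ne {h₁ h₂ : ℝ → ℝ} (hm₁ : StrictMono h₁)
    (hm₂ : StrictMono h₂) (hc₁ : Continuous h₁) (hc₂ : Continuous h₂) (h₁0 : h₁ 0 = 0)
    {y₁ y₂ z₁ z₂ : ℝ} (hy : 0 < y₁ ∧ y₁ < y₂ ∨ y₂ < y₁ ∧ y₁ < 0)
    (he₁ : h₁ y₁ + h₂ z₁ = 0) (he₂ : h₁ y₂ + h₂ z₂ = 0) :
    (∫ s in (0 : ℝ)..y₁, h₁ s) + (∫ s in (0 : ℝ)..z₁, h₂ s) ≠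
      (∫ s in (0 : ℝ)..y₂, h₁ s) + ∫ s in (0 : ℝ)..z₂, h₂ s := by
  have i₁ := hm₁.monotone.mul_sub_le_integral hc₁ y₁ y₂
  have i₂ := hm₂.monotone.mul_sub_le_integral hc₂ z₁ z₂
  rw [show h₂ z₁ = -h₁ y₁ by linarith] at i₂
  rcases hy with ⟨hp, hlt⟩ | ⟨hlt, hn⟩
  · have hz : z₂ < z₁ := hm₂.lt_iff_lt.1 (by linarith [hm₁ hlt])
    have hpos : 0 < h₁ y₁ := h₁0 ▸ hm₁ hp
    nlinarith [mul_pos hpos (sub_pos.2 hlt), mul_pos hpos (sub_pos.2 hz)]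
  · have hz : z₁ < z₂ := hm₂.lt_iff_lt.1 (by linarith [hm₁ hlt])
    have hneg : h₁ y₁ < 0 := h₁0 ▸ hm₁ hn
    nlinarith [mul_pos (neg_pos.2 hneg) (sub_pos.2 hlt), mul_pos (neg_pos.2 hneg) (sub_pos.2 hz)]

/-- A continuous function which is frequently below `y` and frequently above `y` at infinity
frequently takes the value `y`. -/
theorem ContinuousOn.frequently_eq_atTop {x : ℝ → ℝ} (hx : ContinuousOn x (Ici 0)) {y : ℝ}
    (hlt : ∃ᶠ t in atTop, x t < y) (hgt : ∃ᶠ t in atTop, y < x t) :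
    ∃ᶠ t in atTop, x t = y := by
  rw [frequently_atTop]
  intro N
  obtain ⟨s, hs, hsy⟩ := frequently_atTop.1 hlt (max N 0)
  obtain ⟨r, hr, hry⟩ := frequently_atTop.1 hgt (max N 0)
  have hsub : Ici (max N 0) ⊆ Ici (0 : ℝ) := Ici_subset_Ici.2 (le_max_right _ _)
  obtain ⟨t, ht, hty⟩ := isPreconnected_Ici.intermediate_value hs hr (hx.mono hsub)
    ⟨hsy.le, hry.le⟩
  exact ⟨t, (le_max_left _ _).trans ht, hty⟩

/-- Main theorem: every global solution of the oscillator converges to an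
equilibrium point `X* ∈ E` with `V(X*) ≤ V(X₀)`. -/
theorem solution_tendsto_equilibrium
    (f₁ f₂ g₁ g₂ h₁ h₂ : ℝ → ℝ) (c : ℝ → ℝ → ℝ → ℝ)
    (hf₁lip : LocallyLipschitz f₁) (hf₂lip : LocallyLipschitz f₂)
    (hg₁lip : LocallyLipschitz g₁) (hg₂lip : LocallyLipschitz g₂)
    (hh₁lip : LocallyLipschitz h₁) (hh₂lip : LocallyLipschitz h₂)
    (hh₁mono : StrictMono h₁) (hh₂mono : StrictMono h₂)
    (hf₁0 : f₁ 0 = 0) (hf₂0 : f₂ 0 = 0) (hg₁0 : g₁ 0 = 0) (hg₂0 : g₂ 0 = 0)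
    (hh₁0 : h₁ 0 = 0) (hh₂0 : h₂ 0 = 0)
    (hfneg : ∀ z < (0:ℝ), 0 < f₁ z ∧ f₂ z < 0)
    (hfpos : ∀ z > (0:ℝ), f₁ z < 0 ∧ 0 < f₂ z)
    (hgpos : ∀ v > (0:ℝ), 0 < g₁ v ∧ g₂ v = 0)
    (hgneg : ∀ v < (0:ℝ), g₁ v = 0 ∧ g₂ v < 0)
    (hclip : LocallyLipschitz (fun p : ℝ × ℝ × ℝ => c p.1 p.2.1 p.2.2))
    (hc0 : ∀ x z : ℝ, c x z 0 = 0)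
    (hcv : ∀ x z v : ℝ, 0 ≤ v * c x z v)
    (x z v : ℝ → ℝ)
    (hx : ∀ t ∈ Set.Ici (0:ℝ), HasDerivWithinAt x (v t) (Set.Ici 0) t)
    (hz : ∀ t ∈ Set.Ici (0:ℝ), HasDerivWithinAt z
      (v t + f₁ (z t) * g₁ (v t) + f₂ (z t) * g₂ (v t)) (Set.Ici 0) t)
    (hv : ∀ t ∈ Set.Ici (0:ℝ), HasDerivWithinAt v
      (-h₁ (x t) - h₂ (z t) - c (x t) (z t) (v t)) (Set.Ici 0) t)
    :
    ∃ xs zs : ℝ,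
      h₁ xs = -h₂ zs ∧
      (∫ s in (0:ℝ)..xs, h₁ s) + (∫ s in (0:ℝ)..zs, h₂ s) + (0:ℝ) ^ 2 / 2 ≤
        (∫ s in (0:ℝ)..(x 0), h₁ s) + (∫ s in (0:ℝ)..(z 0), h₂ s) +
          (v 0) ^ 2 / 2 ∧
      Filter.Tendsto x Filter.atTop (nhds xs) ∧
      Filter.Tendsto z Filter.atTop (nhds zs) ∧
      Filter.Tendsto v Filter.atTop (nhds 0) := by
  have cf₁ := hf₁lip.continuous
  have cf₂ := hf₂lip.continuous
  have cg₁ := hg₁lip.continuous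
  have cg₂ := hg₂lip.continuous
  have ch₁ := hh₁lip.continuous
  have ch₂ := hh₂lip.continuous
  have cc := hclip.continuous
  set H₁ : ℝ → ℝ := fun y => ∫ s in (0 : ℝ)..y, h₁ s with hH₁
  set H₂ : ℝ → ℝ := fun y => ∫ s in (0 : ℝ)..y, h₂ s with hH₂
  have dH₁ : ∀ y, HasDerivAt H₁ (h₁ y) y := fun y => (ch₁.integral_hasStrictDerivAt 0 y).hasDerivAt
  have dH₂ : ∀ y, HasDerivAt H₂ (h₂ y) y := fun y => (ch₂.integral_hasStrictDerivAt 0 y).hasDerivAt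
  have cH₁ : Continuous H₁ := continuous_iff_continuousAt.2 fun y => (dH₁ y).continuousAt
  have cH₂ : Continuous H₂ := continuous_iff_continuousAt.2 fun y => (dH₂ y).continuousAt
  have nH₁ : ∀ y, 0 ≤ H₁ y := hh₁mono.integral_nonneg_of_map_zero ch₁ hh₁0
  have nH₂ : ∀ y, 0 ≤ H₂ y := hh₂mono.integral_nonneg_of_map_zero ch₂ hh₂0
  let R : ℝ → ℝ → ℝ := fun z v => f₁ z * g₁ v + f₂ z * g₂ v
  have hR0 : ∀ v, R 0 v = 0 := fun v => by simp [R, hf₁0, hf₂0]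
  have hRle : ∀ z v, h₂ z * R z v ≤ 0 := by
    intro z v
    have hg₁n : 0 ≤ g₁ v := by
      rcases lt_trichotomy v 0 with h | h | h
      · exact (hgneg v h).1.ge
      · rw [h, hg₁0]
      · exact (hgpos v h).1.le
    have hg₂n : g₂ v ≤ 0 := by
      rcases lt_trichotomy v 0 with h | h | h
      · exact (hgneg v h).2.le
      · rw [h, hg₂0]
      · exact (hgpos v h).2.le
    rcases lt_trichotomy z 0 with h | h | h
    · have h2 : h₂ z < 0 := hh₂0 ▸ hh₂mono h
      have h3 : 0 ≤ R z v := add_nonneg (mul_nonneg (hfneg z h).1.le hg₁n)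
        (mul_nonneg_of_nonpos_of_nonpos (hfneg z h).2.le hg₂n)
      exact mul_nonpos_of_nonpos_of_nonneg h2.le h3
    · simp [h, hh₂0]
    · have h2 : 0 < h₂ z := hh₂0 ▸ hh₂mono h
      have h3 : R z v ≤ 0 := add_nonpos (mul_nonpos_of_nonpos_of_nonneg (hfpos z h).1.le hg₁n)
        (mul_nonpos_of_nonneg_of_nonpos (hfpos z h).2.le hg₂n)
      exact mul_nonpos_of_nonneg_of_nonpos h2.le h3
  have hReq : ∀ z v, h₂ z * R z v = 0 → z * v = 0 := by
    intro z v h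
    by_contra hzv
    obtain ⟨hz0, hv0⟩ := mul_ne_zero_iff.1 hzv
    have hh : h₂ z ≠ 0 := fun h' => hz0 (hh₂mono.injective (h'.trans hh₂0.symm))
    have hf₁n : f₁ z ≠ 0 := hz0.lt_or_gt.elim (fun h => (hfneg z h).1.ne') fun h => (hfpos z h).1.ne
    have hf₂n : f₂ z ≠ 0 := hz0.lt_or_gt.elim (fun h => (hfneg z h).2.ne) fun h => (hfpos z h).2.ne'
    have hR := (mul_eq_zero.1 h).resolve_left hh
    rcases hv0.lt_or_gt with h | h
    · have := hgneg v h
      simp [R, this.1, hf₂n, this.2.ne] at hR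
    · have := hgpos v h
      simp [R, this.2, hf₁n, this.1.ne'] at hR
  let X : ℝ → ℝ × ℝ × ℝ := fun t => (x t, z t, v t)
  let zdot : ℝ × ℝ × ℝ → ℝ := fun p => p.2.2 + f₁ p.2.1 * g₁ p.2.2 + f₂ p.2.1 * g₂ p.2.2
  let vdot : ℝ × ℝ × ℝ → ℝ := fun p => -h₁ p.1 - h₂ p.2.1 - c p.1 p.2.1 p.2.2
  let V : ℝ × ℝ × ℝ → ℝ := fun p => H₁ p.1 + H₂ p.2.1 + p.2.2 ^ 2 / 2
  let Vdot : ℝ × ℝ × ℝ → ℝ := fun p => h₂ p.2.1 * R p.2.1 p.2.2 - p.2.2 * c p.1 p.2.1 p.2.2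
  have czdot : Continuous zdot := by fun_prop
  have cvdot : Continuous vdot := by fun_prop
  have cV : Continuous V := by fun_prop
  have cVdot : Continuous Vdot := by
    have : Continuous fun p : ℝ × ℝ × ℝ => R p.2.1 p.2.2 := by fun_prop
    fun_prop
  have dV : ∀ t ∈ Ici (0 : ℝ), HasDerivWithinAt (fun t => V (X t)) (Vdot (X t)) (Ici 0) t := by
    intro t ht
    have e := (((dH₁ (x t)).comp_hasDerivWithinAt t (hx t ht)).add
      ((dH₂ (z t)).comp_hasDerivWithinAt t (hz t ht))).add (((hv t ht).pow 2).div_const 2)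
    refine e.congr_deriv ?_
    simp only [Vdot, X, R]
    push_cast
    ring
  have hVdot : ∀ p, Vdot p ≤ 0 := fun p => by
    have := hRle p.2.1 p.2.2
    have := hcv p.1 p.2.1 p.2.2
    simp only [Vdot]
    linarith
  have aV : AntitoneOn (fun t => V (X t)) (Ici 0) :=
    antitoneOn_of_hasDerivWithinAt_nonpos (convex_Ici 0)
      (fun t ht => (dV t ht).continuousWithinAt)
      (fun t ht => (dV t (interior_subset ht)).mono interior_subset) fun t _ => hVdot _
  have hV0 : ∀ p, 0 ≤ V p := fun p => by
    have := nH₁ p.1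
    have := nH₂ p.2.1
    positivity
  obtain ⟨L, hL⟩ : ∃ L, Tendsto (fun t => V (X t)) atTop (𝓝 L) := by
    have ha : Antitone fun t => V (X (max t 0)) := fun s t hst =>
      aV (mem_Ici.2 (le_max_right _ _)) (mem_Ici.2 (le_max_right _ _)) (max_le_max_right 0 hst)
    refine ⟨_, (tendsto_atTop_ciInf ha ⟨0, by rintro _ ⟨t, rfl⟩; exact hV0 _⟩).congr' ?_⟩
    filter_upwards [eventually_ge_atTop 0] with t ht
    simp only [max_eq_left ht]
  obtain ⟨a₁, b₁, hab₁⟩ := hh₁mono.exists_mem_Icc_of_integral_le ch₁ hh₁0 (V (X 0))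
  obtain ⟨a₂, b₂, hab₂⟩ := hh₂mono.exists_mem_Icc_of_integral_le ch₂ hh₂0 (V (X 0))
  let K : Set (ℝ × ℝ × ℝ) :=
    Icc a₁ b₁ ×ˢ Icc a₂ b₂ ×ˢ Icc (-(V (X 0) + 1)) (V (X 0) + 1)
  have hK : IsCompact K := isCompact_Icc.prod (isCompact_Icc.prod isCompact_Icc)
  have hXK : ∀ t ∈ Ici (0 : ℝ), X t ∈ K := by
    intro t ht
    have hVt : H₁ (x t) + H₂ (z t) + v t ^ 2 / 2 ≤ V (X 0) := aV self_mem_Ici ht ht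
    have n₁ := nH₁ (x t)
    have n₂ := nH₂ (z t)
    have n₃ := sq_nonneg (v t)
    refine ⟨hab₁ _ (by change H₁ (x t) ≤ _; linarith),
      hab₂ _ (by change H₂ (z t) ≤ _; linarith), ?_, ?_⟩
    · change -(V (X 0) + 1) ≤ v t
      nlinarith [sq_nonneg (v t + 1)]
    · change v t ≤ V (X 0) + 1
      nlinarith [sq_nonneg (v t - 1)]
  have hXK' : ∀ᶠ t in atTop, X t ∈ K := (eventually_ge_atTop 0).mono hXK
  have uX : UniformContinuousOn X (Ici 0) := by
    have cX : Continuous fun p : ℝ × ℝ × ℝ => (p.2.2, zdot p, vdot p) := by fun_prop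
    obtain ⟨C, hC⟩ := hK.exists_bound_of_continuousOn cX.continuousOn
    refine (Convex.lipschitzOnWith_of_nnnorm_hasDerivWithin_le (C := C.toNNReal) (convex_Ici 0)
      (fun t ht => (hx t ht).prodMk ((hz t ht).prodMk (hv t ht))) fun t ht => ?_).uniformContinuousOn
    rw [← NNReal.coe_le_coe, coe_nnnorm]
    exact (hC _ (hXK t ht)).trans (Real.le_coe_toNNReal C)
  have barbalat : ∀ {F : ℝ → ℝ} {G : ℝ × ℝ × ℝ → ℝ} {l : ℝ}, Continuous G →
      (∀ t ∈ Ici (0 : ℝ), HasDerivWithinAt F (G (X t)) (Ici 0) t) →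
      Tendsto F atTop (𝓝 l) → Tendsto (fun t => G (X t)) atTop (𝓝 0) := fun cG hF hl =>
    tendsto_zero_of_hasDerivWithinAt_of_uniformContinuousOn hF
      ((hK.uniformContinuousOn_of_continuous cG.continuousOn).comp uX hXK) hl
  have tzv : Tendsto (fun t => z t * v t) atTop (𝓝 0) := by
    refine hK.tendsto_comp_of_tendsto_comp hXK' cVdot (barbalat cVdot dV hL)
      (φ := fun p => p.2.1 * p.2.2) (by fun_prop) fun p hp => hReq _ _ ?_
    have := hRle p.2.1 p.2.2
    have := hcv p.1 p.2.1 p.2.2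
    simp only [Vdot] at hp
    linarith
  have tv : Tendsto v atTop (𝓝 0) := by
    have cG : Continuous fun p : ℝ × ℝ × ℝ => zdot p * p.2.2 + p.2.1 * vdot p := by fun_prop
    have tG := barbalat cG (fun t ht => (hz t ht).mul (hv t ht)) tzv
    refine hK.tendsto_comp_of_tendsto_comp hXK'
      (D := fun p => (p.2.1 * p.2.2, zdot p * p.2.2 + p.2.1 * vdot p)) (by fun_prop)
      (tzv.prodMk_nhds tG) (φ := fun p => p.2.2) (by fun_prop) fun p hp => ?_
    obtain ⟨h1, h2⟩ := Prod.ext_iff.1 hp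
    rcases mul_eq_zero.1 h1 with h | h
    · simpa [zdot, h, hf₁0, hf₂0] using h2
    · exact h
  have tvdot : Tendsto (fun t => vdot (X t)) atTop (𝓝 0) := barbalat cvdot hv tv
  have hE : ∀ p : ℝ × ℝ × ℝ, p.2.2 = 0 → vdot p = 0 → h₁ p.1 + h₂ p.2.1 = 0 := by
    intro p h1 h2
    simp only [vdot, h1, hc0] at h2
    linarith
  let D : ℝ × ℝ × ℝ → ℝ × ℝ × ℝ × ℝ := fun p => (p.1, p.2.2, vdot p, V p)
  have cD : Continuous D := by fun_prop
  have limit_point : ∀ {l : Filter ℝ} [l.NeBot] {y : ℝ}, l ≤ atTop → Tendsto x l (𝓝 y) →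
      ∃ w, h₁ y + h₂ w = 0 ∧ H₁ y + H₂ w = L := by
    intro l _ y hl hy
    obtain ⟨p, -, hp⟩ := hK.exists_eq_of_tendsto_comp (hl hXK') cD (hy.prodMk_nhds
      ((tv.mono_left hl).prodMk_nhds ((tvdot.mono_left hl).prodMk_nhds (hL.mono_left hl))))
    simp only [D, Prod.mk.injEq] at hp
    obtain ⟨rfl, h2, h3, h4⟩ := hp
    refine ⟨p.2.1, hE p h2 h3, ?_⟩
    simpa [V, h2] using h4
  have cx : ContinuousOn x (Ici 0) := fun t ht => (hx t ht).continuousWithinAt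
  have hbdd : ∀ᶠ t in atTop, x t ∈ Icc a₁ b₁ := hXK'.mono fun t ht => ht.1
  obtain ⟨xs, hxs⟩ : ∃ xs, Tendsto x atTop (𝓝 xs) := by
    refine tendsto_of_no_upcrossings dense_univ ?_
      (isBoundedUnder_of_eventually_le (hbdd.mono fun t ht => ht.2))
      (isBoundedUnder_of_eventually_ge (hbdd.mono fun t ht => ht.1))
    rintro a - b - hab ⟨hlt, hgt⟩
    have between : ∀ y ∈ Ioo a b, ∃ w, h₁ y + h₂ w = 0 ∧ H₁ y + H₂ w = L := by
      intro y hy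
      have hfr := cx.frequently_eq_atTop (hlt.mono fun t ht => ht.trans hy.1)
        (hgt.mono fun t ht => hy.2.trans ht)
      have : (atTop ⊓ 𝓟 {t | x t = y}).NeBot := frequently_mem_iff_neBot.1 hfr
      refine limit_point (l := atTop ⊓ 𝓟 {t | x t = y}) inf_le_left
        (tendsto_const_nhds.congr' ?_)
      filter_upwards [mem_inf_of_right (mem_principal_self _)] with t ht using ht.symm
    obtain ⟨y₁, y₂, hy₁, hy₂, hy⟩ : ∃ y₁ y₂, y₁ ∈ Ioo a b ∧ y₂ ∈ Ioo a b ∧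
        (0 < y₁ ∧ y₁ < y₂ ∨ y₂ < y₁ ∧ y₁ < 0) := by
      rcases lt_or_ge 0 b with hb | hb
      · obtain ⟨y₁, h1, h2⟩ := exists_between (max_lt hab hb)
        obtain ⟨y₂, h3, h4⟩ := exists_between h2
        obtain ⟨ha, h0⟩ := max_lt_iff.1 h1
        exact ⟨y₁, y₂, ⟨ha, h2⟩, ⟨ha.trans h3, h4⟩, Or.inl ⟨h0, h3⟩⟩
      · obtain ⟨y₁, h1, h2⟩ := exists_between hab
        obtain ⟨y₂, h3, h4⟩ := exists_between h1
        exact ⟨y₁, y₂, ⟨h1, h2⟩, ⟨h3, h4.trans h2⟩, Or.inr ⟨h4, h2.trans_le hb⟩⟩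
    obtain ⟨w₁, e₁, l₁⟩ := between y₁ hy₁
    obtain ⟨w₂, e₂, l₂⟩ := between y₂ hy₂
    exact hh₁mono.integral_add_integral_ne hh₂mono ch₁ ch₂ hh₁0 hy e₁ e₂ (l₁.trans l₂.symm)
  obtain ⟨zs, hs, hsL⟩ := limit_point le_rfl hxs
  refine ⟨xs, zs, by linarith, ?_, hxs, ?_, tv⟩
  · have hle : L ≤ V (X 0) := le_of_tendsto hL
      ((eventually_ge_atTop 0).mono fun t ht => aV self_mem_Ici ht ht)
    change H₁ xs + H₂ zs + (0 : ℝ) ^ 2 / 2 ≤ V (X 0)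
    rw [hsL]
    simpa using hle
  · refine hK.tendsto_comp_of_tendsto_comp hXK' cD (hxs.prodMk_nhds
      (tv.prodMk_nhds (tvdot.prodMk_nhds hL))) (φ := fun p => p.2.1) (by fun_prop)
      fun p hp => hh₂mono.injective ?_
    simp only [D, Prod.mk.injEq] at hp
    obtain ⟨h1, h2, h3, -⟩ := hp
    have := hE p h2 h3
    rw [h1] at this
    linarith
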